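/- Let B_{k,n}^r be the set of r-partitions (ν, τ): sequences 1 = ν_1 ≤ ... ≤ ν_{r+1} = kn+1 and 1 = τ_1 ≤ ... ≤ τ_{r+1} = kn+1 with (ν_{j+1}-ν_j)+(τ_{j+1}-τ_j) ∈ {2n-1, 2n} for j ≤ r-1 and (ν_{r+1}-ν_r)+(τ_{r+1}-τ_r) < 2n. Then |B_{k,n}^r| ≤ 2^{r-1} · 2n · C(nk + r - 1, r - 1), where C denotes the binomial coefficient. -/

import Mathlib

/-- Counting bound for `r`-partitions: the number of pairs `(ν, τ)` with
`1 = ν₁ ≤ ⋯ ≤ ν_{r+1} = kn+1`, `1 = τ₁ ≤ ⋯ ≤ τ_{r+1} = kn+1`,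
`(ν_{j+1}-ν_j) + (τ_{j+1}-τ_j) ∈ {2n-1, 2n}` for `j ≤ r-1` and `< 2n` for the
last block, is at most `2^{r-1} · 2n · C(nk+r-1, r-1)`. -/
theorem r_partition_count_bound (n k r : ℕ) (hn : 1 ≤ n) (hr : 1 ≤ r) :
    Set.ncard {p : (Fin (r + 1) → ℕ) × (Fin (r + 1) → ℕ) |
        p.1 0 = 1 ∧ p.2 0 = 1 ∧
        p.1 (Fin.last r) = k * n + 1 ∧ p.2 (Fin.last r) = k * n + 1 ∧
        Monotone p.1 ∧ Monotone p.2 ∧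
        (∀ j : Fin r, (j : ℕ) + 1 < r →
          (p.1 j.succ - p.1 j.castSucc) + (p.2 j.succ - p.2 j.castSucc) = 2 * n - 1 ∨
          (p.1 j.succ - p.1 j.castSucc) + (p.2 j.succ - p.2 j.castSucc) = 2 * n) ∧
        (∀ j : Fin r, (j : ℕ) + 1 = r →
          (p.1 j.succ - p.1 j.castSucc) + (p.2 j.succ - p.2 j.castSucc) < 2 * n)}
      ≤ 2 ^ (r - 1) * (2 * n) * Nat.choose (n * k + r - 1) (r - 1) := by
  obtain ⟨m, rfl⟩ : ∃ m, r = m + 1 := ⟨r - 1, by omega⟩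
  have key : ∀ S : Set ((Fin (m + 1 + 1) → ℕ) × (Fin (m + 1 + 1) → ℕ)),
      (∀ p ∈ S, p.1 0 = 1 ∧ p.2 0 = 1 ∧
        p.1 (Fin.last (m + 1)) = k * n + 1 ∧ p.2 (Fin.last (m + 1)) = k * n + 1 ∧
        Monotone p.1 ∧ Monotone p.2 ∧
        (∀ j : Fin (m + 1), (j : ℕ) + 1 < m + 1 →
          (p.1 j.succ - p.1 j.castSucc) + (p.2 j.succ - p.2 j.castSucc) = 2 * n - 1 ∨
          (p.1 j.succ - p.1 j.castSucc) + (p.2 j.succ - p.2 j.castSucc) = 2 * n)) →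
      S.ncard ≤ 2 ^ m * Nat.choose (k * n + m) m := by
    intro S hS
    let g : ((Fin (m + 1 + 1) → ℕ) × (Fin (m + 1 + 1) → ℕ)) → Fin m → ℕ :=
      fun p i => p.1 i.succ.castSucc - 1 + i
    let b : ((Fin (m + 1 + 1) → ℕ) × (Fin (m + 1 + 1) → ℕ)) → Fin m → Bool :=
      fun p i => decide ((p.1 i.castSucc.succ - p.1 i.castSucc.castSucc) +
        (p.2 i.castSucc.succ - p.2 i.castSucc.castSucc) = 2 * n)
    let T : Finset ((Fin m → Bool) × Finset ℕ) :=
      Finset.univ ×ˢ Finset.powersetCard m (Finset.range (k * n + m))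
    have hT : T.card = 2 ^ m * Nat.choose (k * n + m) m := by
      simp [T, Finset.card_product]
    have hpos : ∀ p ∈ S, ∀ i, 1 ≤ p.1 i ∧ p.1 i ≤ k * n + 1 := by
      intro p hp i
      obtain ⟨h1, h2, h3, h4, h5, h6, h7⟩ := hS p hp
      have a := h5 (Fin.zero_le i)
      have c := h5 (Fin.le_last i)
      omega
    have hg : ∀ p ∈ S, StrictMono (g p) := by
      intro p hp i j hij
      obtain ⟨h1, h2, h3, h4, h5, h6, h7⟩ := hS p hp
      have hle : i.succ.castSucc ≤ j.succ.castSucc := by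
        rw [Fin.le_def]; simp; exact hij.le
      have a := h5 hle
      have hij' : (i : ℕ) < j := hij
      simp only [g]
      omega
    rw [← hT, ← Set.ncard_coe_finset]
    refine Set.ncard_le_ncard_of_injOn (fun p => (b p, Finset.univ.image (g p))) ?_ ?_
      (Finset.finite_toSet T)
    · intro p hp
      simp only [T, Finset.coe_product, Set.mem_prod, Finset.mem_coe, Finset.mem_univ, true_and,
        Finset.mem_powersetCard]
      refine ⟨?_, ?_⟩
      · intro x hx
        obtain ⟨i, -, rfl⟩ := Finset.mem_image.1 hx
        have := hpos p hp i.succ.castSucc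
        have := i.isLt
        simp only [g, Finset.mem_range]
        omega
      · rw [Finset.card_image_of_injective _ (hg p hp).injective]; simp
    · intro p hp q hq hpq
      simp only [Prod.mk.injEq] at hpq
      obtain ⟨hb, hi⟩ := hpq
      have hgg : g p = g q := by
        apply ((hg p hp).range_inj (hg q hq)).1
        have := congrArg (fun s : Finset ℕ => (s : Set ℕ)) hi
        simpa using this
      obtain ⟨h1, h2, h3, h4, h5, h6, h7⟩ := hS p hp
      obtain ⟨k1, k2, k3, k4, k5, k6, k7⟩ := hS q hq
      have e1 : p.1 = q.1 := by
        funext i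
        induction i using Fin.lastCases with
        | last => rw [h3, k3]
        | cast i =>
          induction i using Fin.cases with
          | zero => exact h1.trans k1.symm
          | succ i =>
            have := congrFun hgg i
            simp only [g] at this
            have a := (hpos p hp i.succ.castSucc).1
            have c := (hpos q hq i.succ.castSucc).1
            omega
      have e2 : p.2 = q.2 := by
        funext i
        induction i using Fin.induction with
        | zero => rw [h2, k2]
        | succ j ih =>
          induction j using Fin.lastCases with
          | last => exact h4.trans k4.symm
          | cast j =>
            have hbj := congrFun hb j
            simp only [b, decide_eq_decide] at hbj
            have u := h7 j.castSucc (by simp)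
            have v := k7 j.castSucc (by simp)
            have a := h6 (Fin.castSucc_lt_succ (i := j.castSucc)).le
            have c := k6 (Fin.castSucc_lt_succ (i := j.castSucc)).le
            rw [e1] at u hbj
            omega
      exact Prod.ext e1 e2
  refine (key _ ?_).trans ?_
  · rintro p ⟨h1, h2, h3, h4, h5, h6, h7, -⟩
    exact ⟨h1, h2, h3, h4, h5, h6, h7⟩
  · have : n * k + (m + 1) - 1 = k * n + m := by rw [mul_comm]; omega
    rw [this, Nat.add_sub_cancel]
    exact Nat.mul_le_mul_right _ (Nat.le_mul_of_pos_right _ (by omega))
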